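/- Let d ≥ 3, let U_0 ⊆ ℤ^d be bounded and non-empty and set U_1 = ℤ^d ∖ U_0. Then for all integers 0 ≤ ℓ' < ℓ and all x ∈ ℤ^d, one has |σ_ℓ(x) − (σ_{ℓ'})_{B(x,2^ℓ)}| ≤ c_0 · 2^{ℓ' − ℓ}, where c_0 = d·2^{d−1} and (σ_{ℓ'})_{B(x,2^ℓ)} denotes the average of the function σ_{ℓ'} over the ball B(x,2^ℓ). -/

import Mathlib

open Finset

open scoped Classical

/-- The closed `ℓ^∞`-ball of radius `r` around `x` in `ℤ^d`, as a `Finset`. -/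
noncomputable def linftyBall (d : ℕ) (x : Fin d → ℤ) (r : ℤ) : Finset (Fin d → ℤ) :=
  Finset.Icc (fun i => x i - r) (fun i => x i + r)

/-- The normalized counting measure `μ_{x,ℓ}(V)` of a set `V ⊆ ℤ^d` in the ball
`B(x, 2^ℓ)`. -/
noncomputable def locDens (d : ℕ) (x : Fin d → ℤ) (ℓ : ℕ) (V : Set (Fin d → ℤ)) : ℝ :=
  ((linftyBall d x (2 ^ ℓ)).filter (fun y => y ∈ V)).card /
    ((linftyBall d x (2 ^ ℓ)).card : ℝ)

/-- The local density function `σ_ℓ` attached to `U_1 = ℤ^d ∖ U_0`. -/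
noncomputable def sigmaDens (d : ℕ) (U₀ : Set (Fin d → ℤ)) (ℓ : ℕ) (x : Fin d → ℤ) : ℝ :=
  locDens d x ℓ U₀ᶜ

/-- The average of a function `f : ℤ^d → ℝ` over the ball `B(x, 2^ℓ)`. -/
noncomputable def ballAvg (d : ℕ) (x : Fin d → ℤ) (ℓ : ℕ) (f : (Fin d → ℤ) → ℝ) : ℝ :=
  (∑ z ∈ linftyBall d x (2 ^ ℓ), f z) / ((linftyBall d x (2 ^ ℓ)).card : ℝ)

theorem card_linftyBall (d : ℕ) (x : Fin d → ℤ) {r : ℤ} (hr : 0 ≤ r) :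
    ((linftyBall d x r).card : ℝ) = (2 * (r : ℝ) + 1) ^ d := by
  have h : ∀ i, (x i + r + 1 - (x i - r)).toNat = (2 * r + 1).toNat := fun i => by
    congr 1; ring
  simp only [linftyBall, Pi.card_Icc, Int.card_Icc, h, prod_const, card_univ, Fintype.card_fin]
  have h' : (((2 * r + 1).toNat : ℤ) : ℝ) = 2 * (r : ℝ) + 1 := by
    rw [Int.toNat_of_nonneg (by omega)]; push_cast; ring
  push_cast at h' ⊢
  rw [← h']

theorem map_addRight_linftyBall (d : ℕ) (x h : Fin d → ℤ) (r : ℤ) :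
    (linftyBall d x r).map (addRightEmbedding h) = linftyBall d (x + h) r := by
  rw [linftyBall, Finset.map_add_right_Icc, linftyBall]
  congr 1 <;> ext i <;> simp only [Pi.add_apply] <;> ring

/-- Double counting: summing a function over all small balls centred in a large ball is the same
as summing it over all large balls centred in a small ball around the origin. -/
theorem sum_sum_linftyBall_comm (d : ℕ) (x : Fin d → ℤ) (r s : ℤ) (f : (Fin d → ℤ) → ℝ) :
    ∑ z ∈ linftyBall d x r, ∑ y ∈ linftyBall d z s, f y =
      ∑ h ∈ linftyBall d 0 s, ∑ y ∈ linftyBall d (x + h) r, f y := by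
  have hz : ∀ z, ∑ y ∈ linftyBall d z s, f y = ∑ h ∈ linftyBall d 0 s, f (z + h) := fun z => by
    rw [← zero_add z, ← map_addRight_linftyBall, sum_map]
    simp [add_comm]
  have hh : ∀ h, ∑ y ∈ linftyBall d (x + h) r, f y = ∑ z ∈ linftyBall d x r, f (z + h) :=
    fun h => by rw [← map_addRight_linftyBall, sum_map]; rfl
  simp only [hz, hh]
  exact sum_comm

/-- Translating a ball of radius `r` by a vector of norm at most `s` keeps most of the ball. -/
theorem le_card_linftyBall_inter (d : ℕ) (x : Fin d → ℤ) {h : Fin d → ℤ} {r s : ℤ}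
    (hs : 0 ≤ s) (hsr : s ≤ r) (hh : h ∈ linftyBall d 0 s) :
    (2 * (r : ℝ) + 1 - s) ^ d ≤ ((linftyBall d x r ∩ linftyBall d (x + h) r).card : ℝ) := by
  simp only [linftyBall, mem_Icc, Pi.le_def, Pi.zero_apply, zero_sub, zero_add] at hh
  have hsub : Finset.Icc (fun i => x i - r + max (h i) 0) (fun i => x i + r + min (h i) 0) ⊆
      linftyBall d x r ∩ linftyBall d (x + h) r := by
    intro y hy
    simp only [linftyBall, mem_inter, mem_Icc, Pi.le_def, Pi.add_apply] at hy ⊢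
    refine ⟨⟨fun i => ?_, fun i => ?_⟩, fun i => ?_, fun i => ?_⟩ <;>
      have h₁ := hy.1 i <;> have h₂ := hy.2 i <;> omega
  refine le_trans ?_ (Nat.cast_le.mpr (card_le_card hsub))
  have hbase : ((2 * r + 1 - s).toNat : ℝ) = 2 * (r : ℝ) + 1 - s := by
    have : (((2 * r + 1 - s).toNat : ℤ) : ℝ) = ((2 * r + 1 - s : ℤ) : ℝ) := by
      rw [Int.toNat_of_nonneg (by omega)]
    push_cast at this
    exact this
  rw [← hbase, ← Nat.cast_pow, Nat.cast_le, Pi.card_Icc]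
  calc (2 * r + 1 - s).toNat ^ d = ∏ _i : Fin d, (2 * r + 1 - s).toNat := by simp
    _ ≤ _ := prod_le_prod' fun i _ => by
      have h₁ := hh.1 i
      have h₂ := hh.2 i
      rw [Int.card_Icc]
      omega

theorem card_filter_sub_card_filter_le {α : Type*} [DecidableEq α] (A B : Finset α) (V : Set α) :
    ((A.filter (· ∈ V)).card : ℝ) - (B.filter (· ∈ V)).card ≤ A.card - (A ∩ B).card := by
  have h₁ : (A.filter (· ∈ V)).card ≤ (B.filter (· ∈ V)).card + (A \ B).card := by
    refine (card_le_card fun y hy => ?_).trans (card_union_le _ _)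
    simp only [mem_union, mem_filter, mem_sdiff] at hy ⊢
    tauto
  have h₂ := card_sdiff_add_card_inter A B
  have h₁' : ((A.filter (· ∈ V)).card : ℝ) ≤ (B.filter (· ∈ V)).card + (A \ B).card := by
    exact_mod_cast h₁
  have h₂' : ((A \ B).card : ℝ) + (A ∩ B).card = A.card := by exact_mod_cast h₂
  linarith

theorem abs_card_filter_linftyBall_sub_le (d : ℕ) (x : Fin d → ℤ) {h : Fin d → ℤ} {r s : ℤ}
    (hs : 0 ≤ s) (hsr : s ≤ r) (hh : h ∈ linftyBall d 0 s) (V : Set (Fin d → ℤ)) :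
    |(((linftyBall d x r).filter (· ∈ V)).card : ℝ) -
        ((linftyBall d (x + h) r).filter (· ∈ V)).card| ≤
      (2 * (r : ℝ) + 1) ^ d * (d * (s / (2 * r + 1))) := by
  have hr : 0 ≤ r := hs.trans hsr
  have hr' : (0 : ℝ) ≤ r := by exact_mod_cast hr
  have hsr' : (s : ℝ) ≤ r := by exact_mod_cast hsr
  have hs' : (0 : ℝ) ≤ s := by exact_mod_cast hs
  have hpos : (0 : ℝ) < 2 * r + 1 := by linarith
  have hle : (s : ℝ) / (2 * r + 1) ≤ 1 := by rw [div_le_one hpos]; linarith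
  have hB := one_add_mul_le_pow (a := -((s : ℝ) / (2 * r + 1))) (by linarith) d
  have hpow : (2 * (r : ℝ) + 1 - s) ^ d =
      (2 * (r : ℝ) + 1) ^ d * (1 + -((s : ℝ) / (2 * r + 1))) ^ d := by
    rw [← mul_pow]; congr 1; field_simp; ring
  have hI := le_card_linftyBall_inter d x hs hsr hh
  have hM := mul_le_mul_of_nonneg_left hB (pow_nonneg hpos.le d)
  have h₁ := card_filter_sub_card_filter_le (linftyBall d x r) (linftyBall d (x + h) r) V
  have h₂ := card_filter_sub_card_filter_le (linftyBall d (x + h) r) (linftyBall d x r) V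
  rw [inter_comm] at h₂
  rw [card_linftyBall d _ hr] at h₁ h₂
  rw [abs_le]
  constructor <;> linarith

/-- The difference between the density in a ball and the average of the densities at a smaller
scale, as an average over translations of the large ball. -/
theorem locDens_sub_ballAvg (d : ℕ) (x : Fin d → ℤ) (ℓ ℓ' : ℕ) (V : Set (Fin d → ℤ)) :
    locDens d x ℓ V - ballAvg d x ℓ (fun z => locDens d z ℓ' V) =
      (∑ h ∈ linftyBall d 0 (2 ^ ℓ'), ((((linftyBall d x (2 ^ ℓ)).filter (· ∈ V)).card : ℝ) -
        ((linftyBall d (x + h) (2 ^ ℓ)).filter (· ∈ V)).card)) /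
      ((2 * 2 ^ ℓ + 1) ^ d * (2 * 2 ^ ℓ' + 1) ^ d) := by
  have hcard : ∀ z k, ((linftyBall d z (2 ^ k)).card : ℝ) = (2 * 2 ^ k + 1) ^ d := fun z k => by
    rw [card_linftyBall d z (by positivity)]; push_cast; rfl
  have hcomm := sum_sum_linftyBall_comm d x (2 ^ ℓ) (2 ^ ℓ') (fun y => if y ∈ V then 1 else 0)
  simp only [sum_boole] at hcomm
  rw [sum_sub_distrib, sum_const, nsmul_eq_mul, hcard, ← hcomm]
  simp only [locDens, ballAvg, hcard, ← sum_div]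
  field_simp

/-- Comparison of the local density at scale `ℓ` with the ball average of the local
density at a smaller scale `ℓ' < ℓ`:
`|σ_ℓ(x) - (σ_{ℓ'})_{B(x,2^ℓ)}| ≤ c₀ 2^{ℓ' - ℓ}` with `c₀ = d 2^{d-1}`. -/
theorem sigma_avg_comparison (d : ℕ) (hd : 3 ≤ d) (U₀ : Set (Fin d → ℤ))
    (hU₀ne : U₀.Nonempty) (hU₀bdd : U₀.Finite)
    (x : Fin d → ℤ) (ℓ ℓ' : ℕ) (hℓ : ℓ' < ℓ) :
    |sigmaDens d U₀ ℓ x - ballAvg d x ℓ (sigmaDens d U₀ ℓ')| ≤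
      ((d : ℝ) * 2 ^ (d - 1)) * (2 : ℝ) ^ ((ℓ' : ℤ) - (ℓ : ℤ)) := by
  have hcard : ((linftyBall d 0 (2 ^ ℓ')).card : ℝ) = (2 * 2 ^ ℓ' + 1) ^ d := by
    rw [card_linftyBall d 0 (by positivity)]; push_cast; rfl
  have hle : (2 : ℤ) ^ ℓ' ≤ 2 ^ ℓ := pow_le_pow_right₀ (by norm_num) hℓ.le
  have hsum := (abs_sum_le_sum_abs _ _).trans <| sum_le_sum fun h hh =>
    abs_card_filter_linftyBall_sub_le d x (r := 2 ^ ℓ) (s := 2 ^ ℓ') (by positivity) hle hh U₀ᶜ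
  rw [sum_const, nsmul_eq_mul, hcard] at hsum
  push_cast at hsum
  change |locDens d x ℓ U₀ᶜ - ballAvg d x ℓ (fun z => locDens d z ℓ' U₀ᶜ)| ≤ _
  rw [locDens_sub_ballAvg, abs_div, abs_of_pos (by positivity : (0 : ℝ) < _ * _),
    div_le_iff₀ (by positivity), zpow_sub₀ two_ne_zero, zpow_natCast, zpow_natCast]
  have hquot : (2 : ℝ) ^ ℓ' / (2 * 2 ^ ℓ + 1) ≤ 2 ^ (d - 1) * (2 ^ ℓ' / 2 ^ ℓ) := by
    have hone : (1 : ℝ) ≤ 2 ^ (d - 1) := one_le_pow₀ (by norm_num)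
    refine le_trans ?_ (le_mul_of_one_le_left (by positivity) hone)
    gcongr
    linarith [pow_pos (two_pos : (0 : ℝ) < 2) ℓ]
  calc _ ≤ _ := hsum
    _ ≤ (2 * 2 ^ ℓ' + 1) ^ d * ((2 * 2 ^ ℓ + 1) ^ d *
        (d * (2 ^ (d - 1) * (2 ^ ℓ' / 2 ^ ℓ)))) := by gcongr
    _ = _ := by ring
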